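/- Assume Δ_{n−1} ≠ 0 and Δ_n = Δ_{n+1} = ⋯ = Δ_{n+j} = 0 for some j ≥ 0, and let G_n be the n-node Gauss quadrature for L. Then G_n has degree of exactness at least 2n+j, i.e. L(q) = G_n(q) for every polynomial q of degree at most 2n+j. -/

import Mathlib

open Polynomial Matrix

/-- `hankelDet m k` is the determinant of the `k × k` Hankel matrix with `(i,j)` entry
`m (i + j)` (0-indexed), i.e. the determinant `Δ_{k-1}` of the paper
(with `hankelDet m 0 = Δ_{-1} = 1`). -/
noncomputable def hankelDet (m : ℕ → ℂ) (k : ℕ) : ℂ :=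
  (Matrix.of fun i j : Fin k => m ((i : ℕ) + (j : ℕ))).det

lemma aux_lin (D : Polynomial ℂ →ₗ[ℂ] ℂ) (N : ℕ) (q : Polynomial ℂ) (hq : q.natDegree < N) :
    D q = ∑ k : Fin N, q.coeff k * D (X ^ (k : ℕ)) := by
  conv_lhs => rw [q.as_sum_range' N hq]
  rw [map_sum, ← Fin.sum_univ_eq_sum_range (fun k => D (monomial k (q.coeff k)))]
  refine Finset.sum_congr rfl fun k _ => ?_
  rw [← C_mul_X_pow_eq_monomial, ← smul_eq_C_mul, map_smul, smul_eq_mul]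

lemma aux_top (D : Polynomial ℂ →ₗ[ℂ] ℂ) (N : ℕ) (h : ∀ k < N, D (X ^ k) = 0)
    (q : Polynomial ℂ) (hq : q.natDegree ≤ N) : D q = q.coeff N * D (X ^ N) := by
  rw [aux_lin D (N + 1) q (by omega), Fin.sum_univ_castSucc]
  rw [Finset.sum_eq_zero]
  · simp
  · intro k _
    simp [h k k.2]

lemma aux_low (D : Polynomial ℂ →ₗ[ℂ] ℂ) (N : ℕ) (h : ∀ k < N, D (X ^ k) = 0)
    (q : Polynomial ℂ) (hq : q.natDegree < N) : D q = 0 := by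
  rw [aux_lin D N q hq]
  exact Finset.sum_eq_zero fun k _ => by simp [h k k.2]

lemma aux_mul (L : Polynomial ℂ →ₗ[ℂ] ℂ) (f : Polynomial ℂ) (N : ℕ)
    (h : ∀ k < N, L (f * X ^ k) = 0)
    (q : Polynomial ℂ) (hq : q.natDegree < N) : L (f * q) = 0 :=
  aux_low (L ∘ₗ LinearMap.mulLeft ℂ f) N (by simpa using h) q hq

lemma aux_mulVec (L : Polynomial ℂ →ₗ[ℂ] ℂ) (m : ℕ → ℂ) (hm : ∀ i, m i = L (X ^ i)) (k : ℕ)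
    (f : Polynomial ℂ) (hf : f.natDegree < k) (a : Fin k) :
    ((Matrix.of fun i j : Fin k => m ((i : ℕ) + (j : ℕ))) *ᵥ (fun i : Fin k => f.coeff i)) a
      = L (f * X ^ (a : ℕ)) := by
  have := aux_lin (L ∘ₗ LinearMap.mulRight ℂ (X ^ (a : ℕ))) k f hf
  simp only [LinearMap.comp_apply, LinearMap.mulRight_apply] at this
  rw [this]
  simp only [Matrix.mulVec, dotProduct, Matrix.of_apply]
  refine Finset.sum_congr rfl fun i _ => ?_
  rw [hm, ← pow_add, mul_comm, add_comm]

lemma aux_nonsing (L : Polynomial ℂ →ₗ[ℂ] ℂ) (m : ℕ → ℂ) (hm : ∀ i, m i = L (X ^ i)) (k : ℕ)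
    (hk : hankelDet m k ≠ 0) (f : Polynomial ℂ) (hf : f.natDegree < k)
    (h : ∀ a < k, L (f * X ^ a) = 0) : f = 0 := by
  by_contra hne
  apply hk
  refine Matrix.exists_mulVec_eq_zero_iff.1 ⟨fun i : Fin k => f.coeff i, ?_, ?_⟩
  · intro h0
    have := congrFun h0 ⟨f.natDegree, hf⟩
    simp at this
    exact hne this
  · funext a
    rw [aux_mulVec L m hm k f hf a]
    exact h a a.2

lemma aux_sing (L : Polynomial ℂ →ₗ[ℂ] ℂ) (m : ℕ → ℂ) (hm : ∀ i, m i = L (X ^ i)) (k : ℕ)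
    (hk : hankelDet m k = 0) : ∃ f : Polynomial ℂ, f ≠ 0 ∧ f.natDegree < k ∧
    ∀ a < k, L (f * X ^ a) = 0 := by
  obtain ⟨v, hv, h0⟩ := Matrix.exists_mulVec_eq_zero_iff.2 hk
  have hkpos : 0 < k := by
    rcases Nat.eq_zero_or_pos k with rfl | h
    · exact absurd (Subsingleton.elim v 0) hv
    · exact h
  let f : Polynomial ℂ := ∑ i : Fin k, monomial (i : ℕ) (v i)
  have hc : (fun i : Fin k => f.coeff i) = v := by
    funext i
    simp [f, finset_sum_coeff, coeff_monomial, Fin.val_inj]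
  have hd : f.natDegree < k := by
    have : f.natDegree ≤ k - 1 := by
      refine natDegree_sum_le_of_forall_le _ _ fun i _ => ?_
      exact (natDegree_monomial_le _).trans (by omega)
    omega
  refine ⟨f, ?_, hd, fun a ha => ?_⟩
  · intro hf
    apply hv
    rw [← hc, hf]
    funext i
    simp
  · rw [← aux_mulVec L m hm k f hd ⟨a, ha⟩, hc, h0]
    rfl

lemma aux_main (L G : Polynomial ℂ →ₗ[ℂ] ℂ) (m : ℕ → ℂ) (hm : ∀ i, m i = L (X ^ i))
    (n j : ℕ) (hn : 1 ≤ n) (hΔ : hankelDet m n ≠ 0)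
    (hzeros : ∀ i ≤ j, hankelDet m (n + 1 + i) = 0)
    (p : Polynomial ℂ) (hp : p.Monic) (hpn : p.natDegree = n) (hG : ∀ f, G (p * f) = 0)
    (hex : ∀ k < 2 * n, (L - G) (X ^ k) = 0) :
    ∀ i ≤ j + 1, ∀ k < 2 * n + i, (L - G) (X ^ k) = 0 := by
  intro i
  induction i with
  | zero => intro _; simpa using hex
  | succ i ih =>
    intro hi k hk
    have ih := ih (by omega)
    rcases Nat.lt_or_ge k (2 * n + i) with h | h
    · exact ih k h
    obtain rfl : k = 2 * n + i := by omega
    by_contra hd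
    have hLp : ∀ g : Polynomial ℂ, L (p * g) = (L - G) (p * g) := by
      intro g; simp [hG]
    obtain ⟨f, hf0, hfd, hf⟩ := aux_sing L m hm _ (hzeros i (by omega))
    have hdec := modByMonic_add_div f p
    set r := f %ₘ p with hr
    set u := f /ₘ p with hu
    have hrd : r.natDegree < n := by
      rw [← hpn]
      exact natDegree_modByMonic_lt f hp (by rintro rfl; simp at hpn; omega)
    have hud : u.natDegree ≤ i := by
      rw [hu, natDegree_divByMonic f hp]; omega
    have hr0 : r = 0 := by
      refine aux_nonsing L m hm n hΔ r hrd fun a ha => ?_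
      have h1 := hf a (by omega)
      rw [← hdec, add_mul, map_add, mul_assoc, hLp, aux_low (L - G) _ ih, add_zero] at h1
      · exact h1
      · have h2 := natDegree_mul_le (p := p) (q := u * X ^ a)
        have h3 := natDegree_mul_le (p := u) (q := X ^ a)
        simp only [natDegree_X_pow] at h3
        omega
    have hfu : f = p * u := by rw [← hdec, hr0, zero_add]
    have hu0 : u ≠ 0 := by rintro h; apply hf0; rw [hfu, h, mul_zero]
    have hnd : (p * X ^ (i - u.natDegree)).natDegree = n + (i - u.natDegree) := by
      rw [hp.natDegree_mul (monic_X_pow _), hpn, natDegree_X_pow]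
    have h1 := aux_mul L f _ hf (p * X ^ (i - u.natDegree)) (by omega)
    rw [hfu, mul_assoc, hLp, ← mul_assoc] at h1
    have hpp : (p * u * (p * X ^ (i - u.natDegree))).natDegree = 2 * n + i := by
      rw [natDegree_mul (mul_ne_zero hp.ne_zero hu0)
        (hp.mul (monic_X_pow _)).ne_zero, hnd, natDegree_mul hp.ne_zero hu0, hpn]
      omega
    rw [aux_top (L - G) _ ih _ hpp.le] at h1
    rcases mul_eq_zero.1 h1 with h2 | h2
    · rw [← hpp, coeff_natDegree, leadingCoeff_eq_zero] at h2
      exact (mul_ne_zero (mul_ne_zero hp.ne_zero hu0) (hp.mul (monic_X_pow _)).ne_zero) h2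
    · exact hd h2

/-- Assume `Δ_{n−1} ≠ 0` and `Δ_n = Δ_{n+1} = ⋯ = Δ_{n+j} = 0` for some
`j ≥ 0`, and let `G_n` be the `n`-node Gauss quadrature for `L` (exact on `𝒫_{2n−1}`,
with nonzero top weights). Then `G_n` has degree of exactness at least `2n + j`:
`L q = G_n q` for every polynomial `q` of degree at most `2n + j`. -/
theorem stmt12 (L : Polynomial ℂ →ₗ[ℂ] ℂ) (m : ℕ → ℂ) (hm : ∀ i, m i = L (X ^ i))
    (n j : ℕ) (hn : 1 ≤ n)
    (hΔ : hankelDet m n ≠ 0)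
    (hzeros : ∀ i ≤ j, hankelDet m (n + 1 + i) = 0)
    (ℓ : ℕ) (node : Fin ℓ → ℂ) (s : Fin ℓ → ℕ) (ω : Fin ℓ → ℕ → ℂ)
    (hinj : Function.Injective node) (hs : ∀ i, 1 ≤ s i) (hsum : ∑ i, s i = n)
    (htop : ∀ i, ω i (s i - 1) ≠ 0)
    (hexact : ∀ q : Polynomial ℂ, q.degree < ((2 * n : ℕ) : WithBot ℕ) →
      L q = ∑ i, ∑ t ∈ Finset.range (s i),
        ω i t * (Polynomial.derivative^[t] q).eval (node i)) :
    ∀ q : Polynomial ℂ, q.degree ≤ ((2 * n + j : ℕ) : WithBot ℕ) →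
      L q = ∑ i, ∑ t ∈ Finset.range (s i),
        ω i t * (Polynomial.derivative^[t] q).eval (node i) := by
  classical
  let G : Polynomial ℂ →ₗ[ℂ] ℂ := ∑ i, ∑ t ∈ Finset.range (s i),
    ω i t • ((Polynomial.leval (node i)) ∘ₗ ((Polynomial.derivative : ℂ[X] →ₗ[ℂ] ℂ[X]) ^ t))
  have hGd : ∀ q, G q = ∑ i, ∑ t ∈ Finset.range (s i),
        ω i t * (Polynomial.derivative^[t] q).eval (node i) := by
    intro q
    simp [G, LinearMap.sum_apply, Module.End.pow_apply, Polynomial.leval_apply]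
  let p : Polynomial ℂ := ∏ i, (X - C (node i)) ^ s i
  have hp : p.Monic := monic_prod_of_monic _ _ fun i _ => (monic_X_sub_C _).pow _
  have hpn : p.natDegree = n := by
    rw [natDegree_prod_of_monic _ _ fun i _ => (monic_X_sub_C _).pow _, ← hsum]
    refine Finset.sum_congr rfl fun i _ => ?_
    rw [(monic_X_sub_C _).natDegree_pow, natDegree_X_sub_C, mul_one]
  have hG : ∀ f, G (p * f) = 0 := by
    intro f
    rw [hGd]
    refine Finset.sum_eq_zero fun i _ => Finset.sum_eq_zero fun t ht => ?_
    have h1 : (X - C (node i)) ^ s i ∣ p * f :=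
      (Finset.dvd_prod_of_mem (fun i => (X - C (node i)) ^ s i) (Finset.mem_univ i)).mul_right f
    have h2 := pow_sub_dvd_iterate_derivative_of_pow_dvd t h1
    have h3 : X - C (node i) ∣ derivative^[t] (p * f) :=
      (dvd_pow_self _ (by have := Finset.mem_range.1 ht; omega)).trans h2
    rw [dvd_iff_isRoot.1 h3, mul_zero]
  have hex : ∀ k < 2 * n, (L - G) (X ^ k) = 0 := by
    intro k hk
    rw [LinearMap.sub_apply, hGd, hexact, sub_self]
    rw [degree_X_pow]
    exact_mod_cast hk
  intro q hq
  have := aux_low (L - G) _ (aux_main L G m hm n j hn hΔ hzeros p hp hpn hG hex (j + 1) le_rfl) q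
    (by have := natDegree_le_of_degree_le hq; omega)
  rw [← hGd]
  exact sub_eq_zero.1 this
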